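/- arXiv:0802.3822 — 2 statements merged into one kernel-verified Lean document; each statement's English description precedes it below -/
import Mathlib

section
/- On a countably infinite set X: (a) below each ideal clone there is an infinite strictly descending chain of ideal clones, i.e., for every ideal I (in our sense) there exists a sequence of ideals (I_n)_{n≥0} in our sense with I_0 = I and C_{I_{n+1}} ⊊ C_{I_n} for all n; (b) there exists an infinite strictly ascending chain of ideal clones, i.e., a sequence of ideals (J_n)_{n≥0} in our sense with C_{J_n} ⊊ C_{J_{n+1}} for all n. -/
/-- The set of all finitary operations on `X`: an element of arity index `n`
is an `(n+1)`-ary operation, so that all arities are `≥ 1`. -/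
abbrev Ops (X : Type) : Type := Σ n : ℕ, (Fin (n + 1) → X) → X

/-- `opImage f A` is the image `f[A^n]` of the `n`-th power of `A` under the
`n`-ary operation `f`. -/
def opImage {X : Type} (f : Ops X) (A : Set X) : Set X :=
  f.2 '' {x | ∀ i, x i ∈ A}

/-- An ideal "in our sense": closed under subsets and finite unions, contains all
finite sets, contains at least one infinite set, and does not contain `X`. -/
def IsIdealInOurSense {X : Type} (I : Set (Set X)) : Prop :=
  (∀ A ∈ I, ∀ B ⊆ A, B ∈ I) ∧
  (∀ A ∈ I, ∀ B ∈ I, A ∪ B ∈ I) ∧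
  (∀ A : Set X, A.Finite → A ∈ I) ∧
  (∃ A ∈ I, A.Infinite) ∧
  (Set.univ : Set X) ∉ I

/-- The clone `C_I` induced by a collection of sets `I`: all operations mapping
powers of `I`-sets into `I`. -/
def idealClone {X : Type} (I : Set (Set X)) : Set (Ops X) :=
  {f | ∀ A ∈ I, opImage f A ∈ I}

/-- The unary part `C_I^{(1)}` of the clone induced by `I`. -/
def unaryPart {X : Type} (I : Set (Set X)) : Set (X → X) :=
  {f | ∀ A ∈ I, f '' A ∈ I}

/-- A clone: a set of finitary operations containing all projections and closed
under composition. -/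
def IsClone {X : Type} (C : Set (Ops X)) : Prop :=
  (∀ (n : ℕ) (i : Fin (n + 1)), (⟨n, fun x => x i⟩ : Ops X) ∈ C) ∧
  ∀ (n m : ℕ) (f : (Fin (n + 1) → X) → X) (g : Fin (n + 1) → (Fin (m + 1) → X) → X),
    (⟨n, f⟩ : Ops X) ∈ C → (∀ i, (⟨m, g i⟩ : Ops X) ∈ C) →
    (⟨m, fun x => f fun i => g i x⟩ : Ops X) ∈ C

/-- The clone generated by a set of operations. -/
def cloneGen {X : Type} (F : Set (Ops X)) : Set (Ops X) :=
  ⋂₀ {C : Set (Ops X) | IsClone C ∧ F ⊆ C}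

/-- A precomplete clone: a proper clone whose only proper cover is the full clone `O`. -/
def IsPrecompleteClone {X : Type} (C : Set (Ops X)) : Prop :=
  IsClone C ∧ C ≠ Set.univ ∧
  ∀ D : Set (Ops X), IsClone D → C ⊂ D → D = Set.univ

/-- The regularization `Î` of `I`: all sets `A` such that every infinite subset
of `A` contains an infinite member of `I`. -/
def regularization {X : Type} (I : Set (Set X)) : Set (Set X) :=
  {A | ∀ B ⊆ A, B.Infinite → ∃ C ⊆ B, C.Infinite ∧ C ∈ I}

theorem clone_ssub {X : Type} [Countable X] {J I : Set (Set X)} (hJ : IsIdealInOurSense J)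
    (hI : IsIdealInOurSense I) (hsub : idealClone J ⊆ idealClone I)
    (A : Set X) (hAI : A ∈ I) (hAJ : A ∉ J) : idealClone J ⊂ idealClone I := by
  obtain ⟨K, hK, hKinf⟩ := hJ.2.2.2.1
  have hAinf : A.Infinite := fun h => hAJ (hJ.2.2.1 A h)
  have : Infinite K := hKinf.to_subtype
  have : Infinite A := hAinf.to_subtype
  obtain ⟨φ⟩ : Nonempty (K ≃ A) := nonempty_equiv_of_countable
  obtain ⟨a₀, ha₀⟩ := hAinf.nonempty
  classical
  let g : X → X := fun x => if h : x ∈ K then (φ ⟨x, h⟩ : X) else a₀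
  have hg : ∀ x, g x ∈ A := by
    intro x
    by_cases h : x ∈ K
    · simp [g, h]
    · simp [g, h, ha₀]
  refine Set.ssubset_iff_subset_ne.2 ⟨hsub, fun heq => ?_⟩
  have hf : (⟨0, fun x => g (x 0)⟩ : Ops X) ∈ idealClone I := by
    intro B _
    refine hI.1 A hAI _ ?_
    rintro _ ⟨x, _, rfl⟩
    exact hg _
  rw [← heq] at hf
  refine hAJ (hJ.1 _ (hf K hK) A ?_)
  intro a ha
  refine ⟨fun _ => (φ.symm ⟨a, ha⟩ : X), fun _ => (φ.symm ⟨a, ha⟩).2, ?_⟩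
  simp [g]

theorem indep_general {X P D : Type} [Countable X] [Countable D] (c : P → Set D)
    (hc : Function.Injective c) (A : Set X) (hA : A.Infinite) :
    ∃ e : P → X → ℕ, ∀ (T : Finset P) (i : P → ℕ),
      {a | a ∈ A ∧ ∀ p ∈ T, e p a = i p}.Infinite := by
  classical
  let Y := Finset D × (Finset D →₀ ℕ) × ℕ
  have : Infinite A := hA.to_subtype
  obtain ⟨φ⟩ : Nonempty (A ≃ Y) := nonempty_equiv_of_countable
  refine ⟨fun p a => if h : a ∈ A then (φ ⟨a, h⟩).2.1 ((φ ⟨a, h⟩).1.filter (· ∈ c p)) else 0, ?_⟩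
  intro T i
  have hsep : ∃ s : Finset D, ∀ p ∈ T, ∀ q ∈ T, s.filter (· ∈ c p) = s.filter (· ∈ c q) → p = q := by
    have : ∀ pq : P × P, ∃ s : Finset D, pq.1 ≠ pq.2 →
        ∃ d ∈ s, ¬ (d ∈ c pq.1 ↔ d ∈ c pq.2) := by
      intro pq
      by_cases h : pq.1 = pq.2
      · exact ⟨∅, fun h' => (h' h).elim⟩
      · have : c pq.1 ≠ c pq.2 := fun h' => h (hc h')
        have : ∃ d, ¬ (d ∈ c pq.1 ↔ d ∈ c pq.2) := by
          by_contra hcon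
          push Not at hcon
          exact this (Set.ext hcon)
        obtain ⟨d, hd⟩ := this
        exact ⟨{d}, fun _ => ⟨d, by simp, hd⟩⟩
    choose s hs using this
    refine ⟨(T ×ˢ T).biUnion s, ?_⟩
    intro p hp q hq hpq
    by_contra hne
    obtain ⟨d, hd, hd'⟩ := hs (p, q) hne
    apply hd'
    have hmem : d ∈ (T ×ˢ T).biUnion s :=
      Finset.mem_biUnion.2 ⟨(p, q), Finset.mem_product.2 ⟨hp, hq⟩, hd⟩
    have h3 : d ∈ ((T ×ˢ T).biUnion s).filter (· ∈ c p) ↔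
        d ∈ ((T ×ˢ T).biUnion s).filter (· ∈ c q) := by rw [hpq]
    rw [Finset.mem_filter, Finset.mem_filter] at h3
    exact ⟨fun h => (h3.1 ⟨hmem, h⟩).2, fun h => (h3.2 ⟨hmem, h⟩).2⟩
  obtain ⟨s, hs⟩ := hsep
  -- the finitely supported function
  have hψ : ∃ ψ : Finset D →₀ ℕ, ∀ p ∈ T, ψ (s.filter (· ∈ c p)) = i p := by
    let F : Finset D → ℕ := fun u =>
      if h : ∃ p ∈ T, s.filter (· ∈ c p) = u then i h.choose else 0
    refine ⟨Finsupp.onFinset (T.image fun p => s.filter (· ∈ c p)) F ?_, ?_⟩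
    · intro u hu
      by_contra hcon
      apply hu
      have : ¬ ∃ p ∈ T, s.filter (· ∈ c p) = u := by
        rintro ⟨p, hp, hpu⟩
        exact hcon (Finset.mem_image.2 ⟨p, hp, hpu⟩)
      simp only [F]
      rw [dif_neg this]
    · intro p hp
      have h : ∃ q ∈ T, s.filter (· ∈ c q) = s.filter (· ∈ c p) := ⟨p, hp, rfl⟩
      have h2 : h.choose = p := hs _ h.choose_spec.1 _ hp h.choose_spec.2
      simp only [Finsupp.onFinset_apply, F]
      rw [dif_pos h, h2]
  obtain ⟨ψ, hψ⟩ := hψ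
  have hinj : Function.Injective (fun n : ℕ => ((φ.symm (s, ψ, n) : A) : X)) := by
    intro n m h
    have := φ.symm.injective (Subtype.ext h)
    exact (Prod.mk.inj (Prod.mk.inj this).2).2
  refine (Set.infinite_range_of_injective hinj).mono ?_
  rintro _ ⟨n, rfl⟩
  refine ⟨(φ.symm (s, ψ, n)).2, ?_⟩
  intro p hp
  simp [hψ p hp]

theorem indep_family {X : Type} [Countable X] (A : Set X) (hA : A.Infinite) :
    ∃ e : (Ops X × Set X) → X → ℕ, ∀ (T : Finset (Ops X × Set X)) (i : Ops X × Set X → ℕ),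
      {a | a ∈ A ∧ ∀ p ∈ T, e p a = i p}.Infinite := by
  classical
  let D := (Σ n : ℕ, (Fin (n + 1) → X) × X) ⊕ X
  let c : Ops X × Set X → Set D := fun p =>
    {d | (∃ x, d = Sum.inl ⟨p.1.1, x, p.1.2 x⟩) ∨ ∃ x ∈ p.2, d = Sum.inr x}
  obtain ⟨a₀, ha₀⟩ := hA.nonempty
  have hc : Function.Injective c := by
    rintro ⟨⟨n, f⟩, B⟩ ⟨⟨m, f'⟩, B'⟩ h
    have h1 : ∀ x, (Sum.inl ⟨n, x, f x⟩ : D) ∈ c (⟨m, f'⟩, B') := by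
      intro x; rw [← h]; exact Or.inl ⟨x, rfl⟩
    have hnm : n = m := by
      have := h1 (fun _ => a₀)
      rcases this with ⟨x, hx⟩ | ⟨x, _, hx⟩
      · have := Sum.inl.inj hx
        exact congrArg Sigma.fst this
      · cases hx
    subst hnm
    have hff : f = f' := by
      funext x
      rcases h1 x with ⟨y, hy⟩ | ⟨x, _, hx⟩
      · have := Sum.inl.inj hy
        simp only [Sigma.mk.injEq, heq_eq_eq, Prod.mk.injEq, true_and] at this
        rw [this.2, this.1]
      · cases hx
    subst hff
    have hB : B = B' := by
      ext x
      have : (Sum.inr x : D) ∈ c (⟨n, f⟩, B) ↔ (Sum.inr x : D) ∈ c (⟨n, f⟩, B') := by rw [h]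
      constructor
      · intro hx
        rcases this.1 (Or.inr ⟨x, hx, rfl⟩) with ⟨y, hy⟩ | ⟨y, hy, hxy⟩
        · cases hy
        · cases hxy; exact hy
      · intro hx
        rcases this.2 (Or.inr ⟨x, hx, rfl⟩) with ⟨y, hy⟩ | ⟨y, hy, hxy⟩
        · cases hy
        · cases hxy; exact hy
    rw [hB]
  exact indep_general c hc A hA

theorem ideal_iUnion {X : Type} {I : Set (Set X)} (hI : IsIdealInOurSense I) (n : ℕ)
    (F : ℕ → Set X) (hF : ∀ i < n, F i ∈ I) : {x | ∃ i < n, x ∈ F i} ∈ I := by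
  induction n with
  | zero => exact hI.2.2.1 _ (by simp)
  | succ n ih =>
    refine hI.1 _ (hI.2.1 _ (ih fun i hi => hF i (by omega)) _ (hF n (by omega))) _ ?_
    rintro x ⟨i, hi, hx⟩
    by_cases h : i = n
    · subst h; exact Or.inr hx
    · exact Or.inl ⟨i, by omega, hx⟩

theorem desc_step {X : Type} [Countable X] (I : Set (Set X)) (hI : IsIdealInOurSense I) :
    ∃ J, IsIdealInOurSense J ∧ idealClone J ⊂ idealClone I := by
  classical
  obtain ⟨A, hAI, hA⟩ := hI.2.2.2.1
  obtain ⟨e, he⟩ := indep_family A hA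
  have hch : ∀ p : Ops X × Set X, ∃ i : ℕ, opImage p.1 p.2 ∉ I →
      opImage p.1 (p.2 \ {a | a ∈ A ∧ e p a = i}) ∉ I := by
    intro p
    by_contra hcon
    push Not at hcon
    have h0 := (hcon 0).1
    apply h0
    refine hI.1 _ (ideal_iUnion hI (p.1.1 + 2)
      (fun i => opImage p.1 (p.2 \ {a | a ∈ A ∧ e p a = i})) (fun i _ => (hcon i).2)) _ ?_
    rintro _ ⟨x, hx, rfl⟩
    have : ∃ i ∈ Finset.range (p.1.1 + 2),
        i ∉ (Finset.univ : Finset (Fin (p.1.1 + 1))).image (fun t => e p (x t)) := by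
      by_contra hc
      push Not at hc
      have h1 := Finset.card_le_card (fun i hi => hc i hi)
      have h2 := Finset.card_image_le (s := (Finset.univ : Finset (Fin (p.1.1 + 1))))
        (f := fun t => e p (x t))
      simp only [Finset.card_range, Finset.card_univ, Fintype.card_fin] at h1 h2
      omega
    obtain ⟨i, hi, hi'⟩ := this
    refine ⟨i, Finset.mem_range.1 hi, x, ?_, rfl⟩
    intro t
    refine ⟨hx t, fun h => hi' ?_⟩
    exact Finset.mem_image.2 ⟨t, Finset.mem_univ _, h.2⟩
  choose i hi using hch
  let J : Set (Set X) :=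
    {B | B ∈ I ∧ ∃ T : Finset (Ops X × Set X), ({a | a ∈ A ∧ ∀ p ∈ T, e p a = i p} ∩ B).Finite}
  have hAJ : A ∉ J := by
    rintro ⟨_, T, hT⟩
    refine he T i (hT.subset ?_)
    exact fun a ha => ⟨ha, ha.1⟩
  obtain ⟨a₀, _⟩ := hA.nonempty
  have hJ : IsIdealInOurSense J := by
    refine ⟨?_, ?_, ?_, ?_, ?_⟩
    · rintro B ⟨hB, T, hT⟩ C hC
      exact ⟨hI.1 _ hB _ hC, T, hT.subset (Set.inter_subset_inter_right _ hC)⟩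
    · rintro B ⟨hB, T, hT⟩ C ⟨hC, T', hT'⟩
      refine ⟨hI.2.1 _ hB _ hC, T ∪ T', (hT.union hT').subset ?_⟩
      rintro a ⟨⟨ha, hp⟩, hB | hC⟩
      · exact Or.inl ⟨⟨ha, fun p hpT => hp p (Finset.mem_union_left _ hpT)⟩, hB⟩
      · exact Or.inr ⟨⟨ha, fun p hpT => hp p (Finset.mem_union_right _ hpT)⟩, hC⟩
    · intro B hB
      exact ⟨hI.2.2.1 B hB, ∅, hB.subset Set.inter_subset_right⟩
    · let p₀ : Ops X × Set X := (⟨0, fun _ => a₀⟩, ∅)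
      refine ⟨{a | a ∈ A ∧ ∀ p ∈ ({p₀} : Finset _), e p a = i p + 1},
        ⟨hI.1 A hAI _ fun a ha => ha.1, {p₀}, ?_⟩, he {p₀} (fun p => i p + 1)⟩
      refine Set.finite_empty.subset ?_
      rintro a ⟨⟨_, h1⟩, ⟨_, h2⟩⟩
      have h1 := h1 p₀ (by simp)
      have h2 := h2 p₀ (by simp)
      omega
    · exact fun h => hI.2.2.2.2 h.1
  refine ⟨J, hJ, clone_ssub hJ hI ?_ A hAI hAJ⟩
  intro f hf B hB
  by_contra hcon
  refine hi (f, B) hcon (hf _ ⟨hI.1 _ hB _ Set.sdiff_subset, {(f, B)}, ?_⟩).1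
  refine Set.finite_empty.subset ?_
  rintro a ⟨⟨h1, h2⟩, h3⟩
  exact h3.2 ⟨h1, h2 _ (by simp)⟩

/-- A fast growing sequence. -/
def NN : ℕ → ℕ
  | 0 => 2
  | (j + 1) => NN j ^ (j * j + j + 2)

theorem NN_two (j : ℕ) : 2 ≤ NN j := by
  induction j with
  | zero => simp [NN]
  | succ j ih => exact ih.trans (by simpa [NN] using Nat.le_self_pow (by omega) (NN j))

theorem NN_strictMono : StrictMono NN := by
  refine strictMono_nat_of_lt_succ fun j => ?_
  calc NN j = NN j ^ 1 := (pow_one _).symm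
    _ < NN j ^ (j * j + j + 2) := Nat.pow_lt_pow_right (NN_two j) (by omega)

theorem NN_lt (j : ℕ) : j + 1 ≤ NN j := by
  induction j with
  | zero => simp [NN]
  | succ j ih => have := NN_strictMono (Nat.lt_succ_self j); simp only [Nat.succ_eq_add_one] at this; omega

/-- The ideals on the naturals used for the ascending chain. -/
def KK (k : ℕ) : Set (Set ℕ) :=
  {K | ∃ C, ∀ j ≥ C, (K ∩ Set.Iio (NN (j + 1))).ncard ≤ NN j ^ (C + j * (j - k))}

theorem KK_sub {k : ℕ} {K L : Set ℕ} (hK : K ∈ KK k) (h : L ⊆ K) : L ∈ KK k := by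
  obtain ⟨C, hC⟩ := hK
  refine ⟨C, fun j hj => le_trans (Set.ncard_le_ncard (Set.inter_subset_inter_left _ h) ?_) (hC j hj)⟩
  exact (Set.finite_Iio _).subset Set.inter_subset_right

theorem KK_union {k : ℕ} {K L : Set ℕ} (hK : K ∈ KK k) (hL : L ∈ KK k) : K ∪ L ∈ KK k := by
  obtain ⟨C, hC⟩ := hK
  obtain ⟨D, hD⟩ := hL
  refine ⟨C + D + 1, fun j hj => ?_⟩
  rw [Set.union_inter_distrib_right]
  have h2 := NN_two j
  have h1 : NN j ^ (C + j * (j - k)) ≤ NN j ^ (C + D + j * (j - k)) :=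
    Nat.pow_le_pow_right (by omega) (by omega)
  have h3 : NN j ^ (D + j * (j - k)) ≤ NN j ^ (C + D + j * (j - k)) :=
    Nat.pow_le_pow_right (by omega) (by omega)
  calc _ ≤ _ := Set.ncard_union_le _ _
    _ ≤ NN j ^ (C + D + j * (j - k)) + NN j ^ (C + D + j * (j - k)) :=
      add_le_add ((hC j (by omega)).trans h1) ((hD j (by omega)).trans h3)
    _ = NN j ^ (C + D + j * (j - k)) * 2 := by ring
    _ ≤ NN j ^ (C + D + j * (j - k)) * NN j := Nat.mul_le_mul_left _ h2
    _ = NN j ^ (C + D + 1 + j * (j - k)) := by rw [← pow_succ]; congr 1; ring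

theorem KK_fin {k : ℕ} {K : Set ℕ} (hK : K.Finite) : K ∈ KK k := by
  refine ⟨K.ncard + 1, fun j hj => ?_⟩
  calc _ ≤ K.ncard := Set.ncard_le_ncard Set.inter_subset_left hK
    _ ≤ NN j := by have := NN_lt j; omega
    _ ≤ _ := Nat.le_self_pow (by omega) _

theorem KK_univ {k : ℕ} : (Set.univ : Set ℕ) ∉ KK k := by
  rintro ⟨C, hC⟩
  have := hC C le_rfl
  have h2 : ((Set.univ : Set ℕ) ∩ Set.Iio (NN (C + 1))).ncard = NN (C + 1) := by
    rw [Set.univ_inter, ← Finset.coe_Iio, Set.ncard_coe_finset]; simp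
  rw [h2] at this
  have h3 : NN C ^ (C + C * (C - k)) < NN (C + 1) := by
    rw [NN]
    refine Nat.pow_lt_pow_right (NN_two C) ?_
    have : C * (C - k) ≤ C * C := Nat.mul_le_mul_left _ (by omega)
    omega
  omega

theorem KK_pick {k : ℕ} {S : Set ℕ} (hS : S ∉ KK k) (g : ℕ → ℕ) (i : ℕ) :
    ∃ j, ∃ T : Finset ℕ, i + k + 1 ≤ j ∧ (T : Set ℕ) ⊆ S ∩ Set.Iio (NN (j + 1)) ∧
      NN j ^ (i + j * (j - k)) < T.card ∧
      ((∃ y, ∀ a ∈ T, g a = y) ∨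
        ((∀ a ∈ T, NN j ≤ g a) ∧ T.card ≤ NN j ^ (i + j * (j - k)) + 1)) := by
  classical
  have : ∃ j ≥ i + k + 2, NN j ^ (i + k + 2 + j * (j - k)) < (S ∩ Set.Iio (NN (j + 1))).ncard := by
    by_contra hcon
    push Not at hcon
    exact hS ⟨i + k + 2, hcon⟩
  obtain ⟨j, hj, hcard⟩ := this
  have hfin : (S ∩ Set.Iio (NN (j + 1))).Finite := (Set.finite_Iio _).subset Set.inter_subset_right
  rw [Set.ncard_eq_toFinset_card _ hfin] at hcard
  set F := hfin.toFinset with hF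
  set q := NN j ^ (i + j * (j - k)) with hq
  have h2 := NN_two j
  have hmul : (Finset.range (NN j + 1)).card * q < F.card := by
    refine lt_of_le_of_lt ?_ hcard
    rw [Finset.card_range]
    calc (NN j + 1) * q ≤ NN j ^ 2 * q := Nat.mul_le_mul_right _ (by nlinarith)
      _ = NN j ^ (2 + (i + j * (j - k))) := by rw [hq, ← pow_add]
      _ ≤ _ := Nat.pow_le_pow_right (by omega) (by omega)
  obtain ⟨y, hy, hyc⟩ := Finset.exists_lt_card_fiber_of_mul_lt_card_of_maps_to
    (f := fun a => min (g a) (NN j)) (s := F) (t := Finset.range (NN j + 1))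
    (fun a _ => Finset.mem_range.2 (Nat.lt_succ_of_le (min_le_right _ _))) hmul
  have hsubF : ∀ a ∈ F, a ∈ S ∩ Set.Iio (NN (j + 1)) := fun a ha => by simpa [hF] using ha
  by_cases hyN : y < NN j
  · refine ⟨j, _, by omega, ?_, hyc, Or.inl ⟨y, ?_⟩⟩
    · intro a ha
      exact hsubF a (Finset.mem_filter.1 ha).1
    · intro a ha
      have := (Finset.mem_filter.1 ha).2
      omega
  · obtain ⟨T, hT, hTc⟩ := Finset.exists_subset_card_eq (Nat.succ_le_of_lt hyc)
    refine ⟨j, T, by omega, ?_, by omega, Or.inr ⟨?_, by omega⟩⟩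
    · intro a ha
      exact hsubF a (Finset.mem_filter.1 (hT ha)).1
    · intro a ha
      have := (Finset.mem_filter.1 (hT ha)).2
      omega

theorem KK_main {n k : ℕ} (hnk : n < k) {S : Set ℕ} (hS : S ∉ KK k) (g : ℕ → ℕ) :
    ∃ T ⊆ S, T ∉ KK k ∧ g '' T ∈ KK n := by
  classical
  by_cases hM : ∃ M, {a | a ∈ S ∧ g a ≤ M} ∉ KK k
  · obtain ⟨M, hM⟩ := hM
    refine ⟨_, fun a ha => ha.1, hM, KK_fin ((Set.finite_Iic M).subset ?_)⟩
    rintro _ ⟨a, ha, rfl⟩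
    exact ha.2
  push Not at hM
  have hM' : ∀ M, {a | a ∈ S ∧ M < g a} ∉ KK k := by
    intro M h
    refine hS (KK_sub (KK_union (hM M) h) fun a ha => ?_)
    by_cases h : g a ≤ M
    · exact Or.inl ⟨ha, h⟩
    · exact Or.inr ⟨ha, by omega⟩
  choose j T hj hTS hTc hT using fun i => KK_pick (hM' (NN i)) g i
  refine ⟨⋃ i, (T i : Set ℕ), ?_, ?_, ?_⟩
  · refine Set.iUnion_subset fun i a ha => (hTS i ha).1.1
  · rintro ⟨C, hC⟩
    have h1 := hC (j C) (by have := hj C; omega)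
    have h2 : (T C).card ≤ ((⋃ i, (T i : Set ℕ)) ∩ Set.Iio (NN (j C + 1))).ncard := by
      rw [← Set.ncard_coe_finset]
      refine Set.ncard_le_ncard ?_ ((Set.finite_Iio _).subset Set.inter_subset_right)
      exact fun a ha => ⟨Set.mem_iUnion.2 ⟨C, ha⟩, (hTS C ha).2⟩
    have := hTc C
    omega
  · refine ⟨1, fun l _ => ?_⟩
    let G : ℕ → Finset ℕ := fun i => ((T i).image g).filter (· < NN (l + 1))
    have hsub : (g '' (⋃ i, (T i : Set ℕ))) ∩ Set.Iio (NN (l + 1)) ⊆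
        ((Finset.range (l + 1)).biUnion G : Finset ℕ) := by
      rintro _ ⟨⟨a, ha, rfl⟩, hl⟩
      obtain ⟨i, hi⟩ := Set.mem_iUnion.1 ha
      have h1 : NN i < g a := (hTS i hi).1.2
      have h2 : i < l + 1 := NN_strictMono.lt_iff_lt.1 (h1.trans hl)
      simp only [Finset.coe_biUnion, Set.mem_iUnion]
      exact ⟨i, by simpa using h2,
        Finset.mem_filter.2 ⟨Finset.mem_image_of_mem _ hi, hl⟩⟩
    have hG : ∀ i ∈ Finset.range (l + 1), (G i).card ≤ NN l ^ (l * (l - n)) := by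
      intro i _
      have h2l := NN_two l
      rcases hT i with ⟨y, hy⟩ | ⟨hge, hcard⟩
      · refine le_trans ?_ (Nat.one_le_pow _ _ (by omega))
        refine Finset.card_le_one.2 ?_
        intro u hu v hv
        obtain ⟨a, ha, rfl⟩ := Finset.mem_image.1 (Finset.mem_filter.1 hu).1
        obtain ⟨b, hb, rfl⟩ := Finset.mem_image.1 (Finset.mem_filter.1 hv).1
        rw [hy a ha, hy b hb]
      · rcases (G i).eq_empty_or_nonempty with h0 | ⟨u, hu⟩
        · simp [h0]
        obtain ⟨hu1, hu2⟩ := Finset.mem_filter.1 hu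
        obtain ⟨a, ha, rfl⟩ := Finset.mem_image.1 hu1
        have hjl : j i < l + 1 := NN_strictMono.lt_iff_lt.1 ((hge a ha).trans_lt hu2)
        have hji := hj i
        have h2 := NN_two (j i)
        have hp : 1 ≤ NN (j i) ^ (i + j i * (j i - k)) := Nat.one_le_pow _ _ (by omega)
        have hexp : i + j i * (j i - k) + 1 ≤ l * (l - n) := by
          calc i + j i * (j i - k) + 1 ≤ j i * (j i - k + 1) := by rw [mul_add]; omega
            _ ≤ l * (l - n) := Nat.mul_le_mul (by omega) (by omega)
        calc (G i).card ≤ ((T i).image g).card := Finset.card_filter_le _ _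
          _ ≤ (T i).card := Finset.card_image_le
          _ ≤ NN (j i) ^ (i + j i * (j i - k)) + 1 := hcard
          _ ≤ NN (j i) ^ (i + j i * (j i - k)) * NN (j i) := by nlinarith
          _ = NN (j i) ^ (i + j i * (j i - k) + 1) := (pow_succ _ _).symm
          _ ≤ NN (j i) ^ (l * (l - n)) := Nat.pow_le_pow_right (by omega) hexp
          _ ≤ NN l ^ (l * (l - n)) :=
            Nat.pow_le_pow_left (NN_strictMono.monotone (by omega)) _
    calc _ ≤ (((Finset.range (l + 1)).biUnion G : Finset ℕ) : Set ℕ).ncard :=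
          Set.ncard_le_ncard hsub (Finset.finite_toSet _)
      _ = ((Finset.range (l + 1)).biUnion G).card := Set.ncard_coe_finset _
      _ ≤ (Finset.range (l + 1)).card * NN l ^ (l * (l - n)) :=
          Finset.card_biUnion_le_card_mul _ _ _ hG
      _ ≤ NN l * NN l ^ (l * (l - n)) := by
          rw [Finset.card_range]; exact Nat.mul_le_mul_right _ (NN_lt l)
      _ = NN l ^ (1 + l * (l - n)) := by rw [pow_add, pow_one]

theorem KK_main' {n k : ℕ} (hnk : n < k) {S : Set ℕ} (hS : S ∉ KK k) (h : ℕ → ℕ × ℕ) :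
    ∃ T ⊆ S, T ∉ KK k ∧ {b | ∃ a ∈ T, h a = (n, b)} ∈ KK n := by
  by_cases h1 : {a | a ∈ S ∧ (h a).1 = n} ∈ KK k
  · refine ⟨{a | a ∈ S ∧ (h a).1 ≠ n}, fun a ha => ha.1, fun h2 => hS ?_, ?_⟩
    · refine KK_sub (KK_union h1 h2) fun a ha => ?_
      by_cases h3 : (h a).1 = n
      · exact Or.inl ⟨ha, h3⟩
      · exact Or.inr ⟨ha, h3⟩
    · refine KK_fin (Set.finite_empty.subset ?_)
      rintro b ⟨a, ha, hab⟩
      exact ha.2 (by rw [hab])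
  · obtain ⟨T, hT, hTk, hTn⟩ := KK_main hnk h1 (fun a => (h a).2)
    refine ⟨T, fun a ha => (hT ha).1, hTk, KK_sub hTn ?_⟩
    rintro b ⟨a, ha, hab⟩
    exact ⟨a, ha, by simp [hab]⟩

theorem KK_multi {n k : ℕ} (hnk : n < k) {ι : Type} (s : Finset ι) {S : Set ℕ} (hS : S ∉ KK k)
    (h : ι → ℕ → ℕ × ℕ) :
    ∃ T ⊆ S, T ∉ KK k ∧ {b | ∃ i ∈ s, ∃ a ∈ T, h i a = (n, b)} ∈ KK n := by
  classical
  induction s using Finset.induction_on with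
  | empty => exact ⟨S, subset_rfl, hS, KK_fin (by simp)⟩
  | insert i s _ ih =>
    obtain ⟨T, hTS, hTk, hTn⟩ := ih
    obtain ⟨U, hUT, hUk, hUn⟩ := KK_main' hnk hTk (h i)
    refine ⟨U, hUT.trans hTS, hUk, KK_sub (KK_union hUn hTn) ?_⟩
    rintro b ⟨i', hi', a, ha, hab⟩
    rcases Finset.mem_insert.1 hi' with rfl | hi'
    · exact Or.inl ⟨a, ha, hab⟩
    · exact Or.inr ⟨i', hi', a, hUT ha, hab⟩

/-- The ascending chain of ideals. -/
def JJ {X : Type} (e : X ≃ ℕ × ℕ) (n : ℕ) : Set (Set X) :=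
  {B | ∀ k, n < k → {a | e.symm (k, a) ∈ B} ∈ KK k}

theorem JJ_ideal {X : Type} (e : X ≃ ℕ × ℕ) (n : ℕ) : IsIdealInOurSense (JJ e n) := by
  refine ⟨?_, ?_, ?_, ?_, ?_⟩
  · intro A hA B hB k hk
    exact KK_sub (hA k hk) fun a ha => hB ha
  · intro A hA B hB k hk
    exact KK_union (hA k hk) (hB k hk)
  · intro A hA k _
    refine KK_fin (hA.preimage (f := fun a => e.symm (k, a)) ?_)
    intro a _ b _ hab
    simpa using hab
  · refine ⟨Set.range fun a => e.symm (0, a), ?_, Set.infinite_range_of_injective ?_⟩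
    · intro k hk
      refine KK_fin (Set.finite_empty.subset ?_)
      rintro a ⟨b, hb⟩
      simp at hb
      omega
    · intro a b hab
      simpa using hab
  · intro h
    exact KK_univ (KK_sub (h (n + 1) (by omega)) fun a _ => Set.mem_univ _)

theorem JJ_step {X : Type} [Countable X] (e : X ≃ ℕ × ℕ) (n : ℕ) :
    idealClone (JJ e n) ⊂ idealClone (JJ e (n + 1)) := by
  classical
  refine clone_ssub (JJ_ideal e n) (JJ_ideal e (n + 1)) ?_
    (Set.range fun a => e.symm (n + 1, a)) ?_ ?_
  · intro f hf B hB k hk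
    by_contra hS
    have : ∀ a, ∃ x : Fin (f.1 + 1) → X, e.symm (k, a) ∈ opImage f B →
        (∀ i, x i ∈ B) ∧ f.2 x = e.symm (k, a) := by
      intro a
      by_cases h : e.symm (k, a) ∈ opImage f B
      · obtain ⟨x, hx, hxa⟩ := h
        exact ⟨x, fun _ => ⟨hx, hxa⟩⟩
      · exact ⟨fun _ => e.symm (k, a), fun h' => (h h').elim⟩
    choose x hx using this
    obtain ⟨T, hTS, hTk, hTn⟩ := KK_multi hk Finset.univ hS (fun i a => e (x a i))
    have hB' : {y | ∃ i, ∃ a ∈ T, y = x a i} ∈ JJ e n := by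
      intro k' hk'
      by_cases h : k' = n + 1
      · subst h
        refine KK_sub hTn ?_
        rintro b ⟨i, a, ha, hab⟩
        exact ⟨i, Finset.mem_univ _, a, ha, by simp [← hab]⟩
      · refine KK_sub (hB k' (by omega)) ?_
        rintro b ⟨i, a, ha, hab⟩
        have := (hx a (hTS ha)).1 i
        rw [← hab] at this
        exact this
    refine hTk (KK_sub (hf _ hB' k (by omega)) ?_)
    intro a ha
    exact ⟨x a, fun i => ⟨i, a, ha, rfl⟩, (hx a (hTS ha)).2⟩
  · intro k hk
    refine KK_fin (Set.finite_empty.subset ?_)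
    rintro a ⟨b, hb⟩
    simp at hb
    omega
  · intro h
    exact KK_univ (KK_sub (h (n + 1) (by omega)) fun a _ => ⟨a, rfl⟩)

/-- (a) Below each ideal clone there is an infinite strictly descending chain of
ideal clones; (b) there is an infinite strictly ascending chain of ideal clones. -/
theorem stmt6 {X : Type} [Countable X] [Infinite X] :
    (∀ I : Set (Set X), IsIdealInOurSense I →
      ∃ Is : ℕ → Set (Set X), Is 0 = I ∧ (∀ n, IsIdealInOurSense (Is n)) ∧
        ∀ n, idealClone (Is (n + 1)) ⊂ idealClone (Is n)) ∧
    (∃ Js : ℕ → Set (Set X), (∀ n, IsIdealInOurSense (Js n)) ∧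
        ∀ n, idealClone (Js n) ⊂ idealClone (Js (n + 1))) := by
  constructor
  · intro I hI
    choose! next h1 h2 using fun I : Set (Set X) => desc_step I
    have hid : ∀ n, IsIdealInOurSense (next^[n] I) := by
      intro n
      induction n with
      | zero => exact hI
      | succ n ih => rw [Function.iterate_succ_apply']; exact h1 _ ih
    refine ⟨fun n => next^[n] I, rfl, hid, fun n => ?_⟩
    simp only [Function.iterate_succ_apply']
    exact h2 _ (hid n)
  · obtain ⟨e⟩ : Nonempty (X ≃ ℕ × ℕ) := nonempty_equiv_of_countable
    exact ⟨JJ e, JJ_ideal e, JJ_step e⟩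
end

section
/- Let F be a non-principal ultrafilter on a countably infinite set X (an ultrafilter containing all cofinite subsets of X). Then a function f : X → X is F-continuous, i.e., f⁻¹[B] ∈ F for every B ∈ F, if and only if its fixed-point set fix(f) = { x ∈ X : f(x) = x } belongs to F. -/
/-- An ultrafilter (as a set of sets): closed under supersets and finite
intersections, not containing `∅`, and containing `A` or `X \ A` for each `A`. -/
def IsUltrafilterSet {X : Type} (F : Set (Set X)) : Prop :=
  (∀ A ∈ F, ∀ B, A ⊆ B → B ∈ F) ∧
  (∀ A ∈ F, ∀ B ∈ F, A ∩ B ∈ F) ∧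
  (∅ : Set X) ∉ F ∧
  ∀ A : Set X, A ∈ F ∨ Set.univ \ A ∈ F

/-- Two-colouring of the part of a self-map of `ℕ` that moves points down. -/
theorem colour_down (f : ℕ → ℕ) : ∃ C : Set ℕ, ∀ x, f x < x → (f x ∈ C ↔ x ∉ C) := by
  let D : ℕ → Bool := WellFounded.fix (r := (· < ·)) (C := fun _ => Bool) wellFounded_lt
    (fun x ih => if h : f x < x then !(ih (f x) h) else true)
  have hD : ∀ x, f x < x → D x = !(D (f x)) := by
    intro x hx
    have := WellFounded.fix_eq (r := (· < ·)) (C := fun _ => Bool) wellFounded_lt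
      (fun x ih => if h : f x < x then !(ih (f x) h) else true) x
    simp only [dif_pos hx] at this
    exact this
  refine ⟨{x | D x = true}, fun x hx => ?_⟩
  simp only [Set.mem_setOf_eq, hD x hx]
  cases D (f x) <;> simp

/-- Two-colouring of a self-map of `ℕ` that moves all points up. -/
theorem colour_up_all (g : ℕ → ℕ) (hg : ∀ x, x < g x) :
    ∃ C : Set ℕ, ∀ x, (g x ∈ C ↔ x ∉ C) := by
  have hinj : ∀ x m n, g^[m] x = g^[n] x → m = n := by
    intro x m n h
    have : StrictMono (fun k => g^[k] x) := by
      apply strictMono_nat_of_lt_succ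
      intro k
      rw [Function.iterate_succ_apply']
      exact hg _
    exact this.injective h
  let S : Setoid ℕ :=
    { r := fun x y => ∃ m n, g^[m] x = g^[n] y
      iseqv :=
        { refl := fun x => ⟨0, 0, rfl⟩
          symm := fun ⟨m, n, h⟩ => ⟨n, m, h.symm⟩
          trans := by
            rintro x y z ⟨m, n, h⟩ ⟨p, q, h'⟩
            refine ⟨p + m, n + q, ?_⟩
            rw [Function.iterate_add_apply, h, ← Function.iterate_add_apply, Nat.add_comm,
              Function.iterate_add_apply, h', ← Function.iterate_add_apply] } }
  let r : ℕ → ℕ := fun x => (Quotient.mk S x).out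
  have hr : ∀ x, ∃ m n, g^[m] x = g^[n] (r x) := fun x => S.symm (Quotient.mk_out (s := S) x)
  have hrg : ∀ x, r (g x) = r x := by
    intro x
    have : Quotient.mk S (g x) = Quotient.mk S x := Quotient.sound ⟨0, 1, rfl⟩
    simp only [r, this]
  have huniq : ∀ x y m n p q, g^[m] x = g^[n] y → g^[p] x = g^[q] y → q + m = n + p := by
    intro x y m n p q h h'
    apply hinj x
    rw [Function.iterate_add_apply, h, Function.iterate_add_apply, h',
      ← Function.iterate_add_apply, ← Function.iterate_add_apply, Nat.add_comm]
  refine ⟨{x | ∃ m n, (m + n) % 2 = 0 ∧ g^[m] x = g^[n] (r x)}, fun x => ?_⟩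
  simp only [Set.mem_setOf_eq, hrg]
  constructor
  · rintro ⟨m, n, hmn, h⟩ ⟨p, q, hpq, h'⟩
    have := huniq x (r x) (m + 1) n p q h h'
    omega
  · intro hx
    obtain ⟨m, n, h⟩ := hr x
    have hodd : (m + n) % 2 = 1 := by
      by_contra hc
      exact hx ⟨m, n, by omega, h⟩
    refine ⟨m, n + 1, by omega, ?_⟩
    rw [Function.iterate_succ_apply', ← h, ← Function.iterate_succ_apply,
      Function.iterate_succ_apply']

theorem colour_up (f : ℕ → ℕ) : ∃ C : Set ℕ, ∀ x, x < f x → (f x ∈ C ↔ x ∉ C) := by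
  obtain ⟨C, hC⟩ := colour_up_all (fun x => if x < f x then f x else x + 1) (by
    intro x
    split_ifs with h
    · exact h
    · exact Nat.lt_succ_self x)
  refine ⟨C, fun x hx => ?_⟩
  have := hC x
  rwa [if_pos hx] at this

/-- Katětov: a unary function is `F`-continuous for a non-principal ultrafilter
`F` iff its fixed-point set belongs to `F`. -/
theorem stmt16 {X : Type} [Countable X] [Infinite X]
    {F : Set (Set X)} (hF : IsUltrafilterSet F)
    (hnp : ∀ A : Set X, A.Finite → Set.univ \ A ∈ F)
    (f : X → X) :
    (∀ B ∈ F, f ⁻¹' B ∈ F) ↔ {x | f x = x} ∈ F := by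
  classical
  obtain ⟨hup, hint, hemp, hult⟩ := hF
  constructor
  · intro hcont
    by_contra hfix
    obtain ⟨e⟩ : Nonempty (X ≃ ℕ) := nonempty_equiv_of_countable
    have hno : ∀ A ∈ F, ∀ E : Set X, ¬ ∀ x ∈ A, (f x ∈ E ↔ x ∉ E) := by
      intro A hA E h
      rcases hult E with hE | hE
      · apply hemp
        refine hup _ (hint _ hA _ (hint _ hE _ (hcont _ hE))) _ ?_
        rintro x ⟨h1, h2, h3⟩
        exact ((h x h1).1 h3 h2).elim
      · apply hemp
        refine hup _ (hint _ hA _ (hint _ hE _ (hcont _ hE))) _ ?_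
        rintro x ⟨h1, h2, h3⟩
        exact (h3.2 ((h x h1).2 h2.2)).elim
    have hfix' := (hult {x | f x = x}).resolve_left hfix
    rcases hult {x | e (f x) < e x} with h | h
    · obtain ⟨C, hC⟩ := colour_down (fun n => e (f (e.symm n)))
      refine hno _ h (e ⁻¹' C) ?_
      intro x hx
      have := hC (e x)
      simp only [Equiv.symm_apply_apply] at this
      exact this hx
    · obtain ⟨C, hC⟩ := colour_up (fun n => e (f (e.symm n)))
      refine hno _ (hint _ h _ hfix') (e ⁻¹' C) ?_
      rintro x ⟨hx, hx'⟩
      have := hC (e x)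
      simp only [Equiv.symm_apply_apply] at this
      apply this
      have h1 : ¬ e (f x) < e x := hx.2
      have h2 : e (f x) ≠ e x := fun h => hx'.2 (e.injective h)
      omega
  · intro hfix B hB
    refine hup _ (hint _ hfix _ hB) _ ?_
    rintro x ⟨h1, h2⟩
    have h1' : f x = x := h1
    change f x ∈ B
    rw [h1']
    exact h2
end
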